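/- Let ρ > 1. Then there exists a weight ω on ℤ⁺ with lim_{n→∞} ωₙ^{1/n} = ρ such that, in the Banach algebra A = ℓ¹(ℤ⁺, ω), neither the maximal ideal M₀ = { f ∈ A : f(0) = 0 } nor the augmentation ideal M₁ = { f ∈ A : Σ_{n∈ℤ⁺} f(n) = 0 } is finitely-generated as an ideal of A. -/

import Mathlib

noncomputable section

open Filter
open scoped BigOperators

/-- Convolution of two functions on the additive monoid `ℤ⁺ = ℕ`:
`(f ∗ g)(n) = ∑_{s+t = n} f(s) g(t)`. -/
def aconv {M : Type*} [Add M] (f g : M → ℂ) : M → ℂ :=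
  fun n => ∑' p : {p : M × M // p.1 + p.2 = n}, f (p : M × M).1 * g (p : M × M).2

/-- The weighted space `ℓ¹(ℤ⁺, ω)`, as a set of functions `ℕ → ℂ`. -/
def l1wN (ω : ℕ → ℝ) : Set (ℕ → ℂ) := {f | Summable fun n => ‖f n‖ * ω n}

/-- A weight on the additive monoid `ℤ⁺ = ℕ`: a function `ω : ℕ → [1,∞)` with `ω 0 = 1`
which is submultiplicative. -/
def IsWeightNat (ω : ℕ → ℝ) : Prop :=
  (∀ n, 1 ≤ ω n) ∧ ω 0 = 1 ∧ ∀ m n, ω (m + n) ≤ ω m * ω n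

/-- `I` is finitely generated as an ideal of the unital commutative Banach algebra
`A = ℓ¹(ℤ⁺, ω)`: namely, `I = Ax₁ + ⋯ + Axₙ` for some `x₁, …, xₙ ∈ A`;
no closure is taken. -/
def IsFinGenIdealOfN (ω : ℕ → ℝ) (I : Set (ℕ → ℂ)) : Prop :=
  ∃ (n : ℕ) (x : Fin n → (ℕ → ℂ)), (∀ i, x i ∈ l1wN ω) ∧
    I = {f | ∃ a : Fin n → (ℕ → ℂ), (∀ i, a i ∈ l1wN ω) ∧
          f = ∑ i, aconv (a i) (x i)}

/-- minimal number of factorials summing to `n` -/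
def LL (n : ℕ) : ℕ := sInf {c | ∃ M : Multiset ℕ, M.card = c ∧ (M.map Nat.factorial).sum = n}

lemma LL_mem (n : ℕ) : ∃ M : Multiset ℕ, M.card = LL n ∧ (M.map Nat.factorial).sum = n := by
  have : LL n ∈ {c | ∃ M : Multiset ℕ, M.card = c ∧ (M.map Nat.factorial).sum = n} :=
    Nat.sInf_mem ⟨n, Multiset.replicate n 1, by simp, by simp⟩
  exact this

lemma LL_le (M : Multiset ℕ) : LL (M.map Nat.factorial).sum ≤ M.card :=
  Nat.sInf_le ⟨M, rfl, rfl⟩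

lemma LL_zero : LL 0 = 0 := by
  have := LL_le 0
  simpa using this

lemma LL_fact (k : ℕ) : LL k.factorial ≤ 1 := by
  have := LL_le {k}
  simpa using this

lemma LL_add (m n : ℕ) : LL (m + n) ≤ LL m + LL n := by
  obtain ⟨M, h1, h2⟩ := LL_mem m
  obtain ⟨N, h3, h4⟩ := LL_mem n
  have := LL_le (M + N)
  simpa [h1, h2, h3, h4] using this

lemma LL_small (k s : ℕ) (hs : s < (k+1).factorial) : s ≤ LL s * k.factorial := by
  obtain ⟨M, h1, h2⟩ := LL_mem s
  have := Multiset.sum_le_card_nsmul (M.map Nat.factorial) k.factorial (by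
    intro x hx
    have hxs : x ≤ s := by rw [← h2]; exact Multiset.single_le_sum (by simp) x hx
    obtain ⟨i, hi, rfl⟩ := Multiset.mem_map.1 hx
    apply Nat.factorial_le
    by_contra hc
    have := Nat.factorial_le (show k + 1 ≤ i by omega)
    omega)
  simpa [h1, h2] using this

lemma LL_key (k s j : ℕ) (hs : s < (k+1).factorial) (hj : j < (k+1).factorial)
    (h : (k+1).factorial ≤ s + j) : k + 1 ≤ LL s + LL j := by
  have h1 := LL_small k s hs
  have h2 := LL_small k j hj
  have h3 : (k+1) * k.factorial ≤ (LL s + LL j) * k.factorial := by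
    rw [← Nat.factorial_succ, add_mul]; omega
  exact Nat.le_of_mul_le_mul_right h3 (Nat.factorial_pos k)

/-- the weight -/
def WW (ρ : ℝ) (n : ℕ) : ℝ := ρ ^ n * 2 ^ LL n

lemma WW_ge (ρ : ℝ) (hρ : 1 < ρ) (n : ℕ) : ρ ^ n ≤ WW ρ n := by
  have : (1:ℝ) ≤ 2 ^ LL n := one_le_pow₀ (by norm_num)
  have h2 : 0 < ρ ^ n := by positivity
  unfold WW; nlinarith

lemma WW_weight (ρ : ℝ) (hρ : 1 < ρ) : IsWeightNat (WW ρ) := by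
  refine ⟨fun n => (one_le_pow₀ hρ.le).trans (WW_ge ρ hρ n), by simp [WW, LL_zero], fun m n => ?_⟩
  have h : (2:ℝ) ^ LL (m+n) ≤ 2 ^ (LL m + LL n) := pow_le_pow_right₀ (by norm_num) (LL_add m n)
  calc WW ρ (m+n) ≤ ρ ^ (m+n) * 2 ^ (LL m + LL n) := by unfold WW; gcongr
    _ = _ := by unfold WW; rw [pow_add, pow_add]; ring

lemma WW_lim (ρ : ℝ) (hρ : 1 < ρ) :
    Tendsto (fun n : ℕ => WW ρ n ^ ((1 : ℝ) / n)) atTop (nhds ρ) := by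
  have hsub : Subadditive (fun n => (LL n : ℝ)) := fun m n => by
    have := LL_add m n
    simp only
    exact_mod_cast this
  have hb : BddBelow (Set.range fun n : ℕ => (LL n : ℝ) / n) :=
    ⟨0, by rintro _ ⟨n, rfl⟩; positivity⟩
  have ht := hsub.tendsto_lim hb
  have h0 : hsub.lim = 0 := by
    apply le_antisymm
    · apply ge_of_tendsto (tendsto_one_div_add_atTop_nhds_zero_nat (𝕜 := ℝ))
      refine Eventually.of_forall fun k => ?_
      refine (hsub.lim_le_div hb (n := (k+1).factorial) (Nat.factorial_ne_zero _)).trans ?_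
      have h1 : (LL (k+1).factorial : ℝ) ≤ 1 := by exact_mod_cast LL_fact _
      have h2 : ((k:ℝ)+1) ≤ ((k+1).factorial : ℝ) := by exact_mod_cast Nat.self_le_factorial (k+1)
      gcongr
    · exact ge_of_tendsto' ht fun n => by positivity
  rw [h0] at ht
  have h3 : Tendsto (fun n : ℕ => ρ * (2:ℝ) ^ ((LL n : ℝ) / n)) atTop (nhds (ρ * (2:ℝ) ^ (0:ℝ))) :=
    ((Real.continuous_const_rpow (by norm_num : (2:ℝ) ≠ 0)).tendsto 0 |>.comp ht).const_mul ρ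
  simp only [Real.rpow_zero, mul_one] at h3
  refine h3.congr' ?_
  filter_upwards [eventually_gt_atTop 0] with n hn
  have hn' : (n:ℝ) ≠ 0 := by positivity
  unfold WW
  rw [Real.mul_rpow (by positivity) (by positivity), ← Real.rpow_natCast, ← Real.rpow_natCast,
    ← Real.rpow_mul (by positivity), ← Real.rpow_mul (by positivity), mul_one_div_cancel hn',
    Real.rpow_one, mul_one_div]

lemma aconv_eq (a x : ℕ → ℂ) (n : ℕ) :
    aconv a x n = ∑ k ∈ Finset.range (n+1), a k * x (n - k) := by
  rw [← Finset.Nat.sum_antidiagonal_eq_sum_range_succ_mk (fun p : ℕ × ℕ => a p.1 * x p.2)]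
  unfold aconv
  rw [← Finset.tsum_subtype (Finset.HasAntidiagonal.antidiagonal n) (fun p : ℕ × ℕ => a p.1 * x p.2)]
  exact (Equiv.tsum_eq (Equiv.subtypeEquivRight (fun p : ℕ × ℕ => by simp))
    (fun p : {p // p ∈ Finset.HasAntidiagonal.antidiagonal n} => a p.1.1 * x p.1.2))

/-- auxiliary majorant -/
def bb (ρ : ℝ) (x : ℕ → ℂ) (k j : ℕ) : ℝ :=
  ‖x j‖ * WW ρ j * (if j < (k+1).factorial then (1/2) ^ (k+1) else 1)

lemma WW_pos (ρ : ℝ) (hρ : 1 < ρ) (n : ℕ) : 0 < WW ρ n := by unfold WW; positivity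

lemma bb_nonneg (ρ : ℝ) (hρ : 1 < ρ) (x : ℕ → ℂ) (k j : ℕ) : 0 ≤ bb ρ x k j := by
  have := WW_pos ρ hρ j
  unfold bb; positivity

lemma bb_le (ρ : ℝ) (hρ : 1 < ρ) (x : ℕ → ℂ) (k j : ℕ) : bb ρ x k j ≤ ‖x j‖ * WW ρ j := by
  have := WW_pos ρ hρ j
  unfold bb
  apply mul_le_of_le_one_right (by positivity)
  split_ifs
  · exact pow_le_one₀ (by norm_num) (by norm_num)
  · exact le_rfl

lemma bb_summable (ρ : ℝ) (hρ : 1 < ρ) (x : ℕ → ℂ) (hx : x ∈ l1wN (WW ρ)) (k : ℕ) :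
    Summable (bb ρ x k) :=
  Summable.of_nonneg_of_le (bb_nonneg ρ hρ x k) (bb_le ρ hρ x k) hx

lemma bb_tendsto (ρ : ℝ) (hρ : 1 < ρ) (x : ℕ → ℂ) (hx : x ∈ l1wN (WW ρ)) :
    Tendsto (fun k => ∑' j, bb ρ x k j) atTop (nhds 0) := by
  have h := tendsto_tsum_of_dominated_convergence (𝓕 := atTop) (f := bb ρ x) (g := fun _ => (0:ℝ))
    (bound := fun j => ‖x j‖ * WW ρ j) hx ?_ ?_
  · simpa using h
  · intro j
    have h1 : Tendsto (fun k : ℕ => ‖x j‖ * WW ρ j * (1/2:ℝ) ^ (k+1)) atTop (nhds (‖x j‖ * WW ρ j * 0)) :=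
      ((tendsto_add_atTop_iff_nat 1).2
        (tendsto_pow_atTop_nhds_zero_of_lt_one (by norm_num) (by norm_num))).const_mul _
    rw [mul_zero] at h1
    refine h1.congr' ?_
    filter_upwards [eventually_ge_atTop j] with k hk
    have := Nat.self_le_factorial (k+1)
    unfold bb
    rw [if_pos (by omega)]
  · refine Eventually.of_forall fun k j => ?_
    rw [Real.norm_of_nonneg (bb_nonneg ρ hρ x k j)]
    exact bb_le ρ hρ x k j

lemma key_bound (ρ : ℝ) (hρ : 1 < ρ) (a x : ℕ → ℂ) (k s j : ℕ) (hs : s < (k+1).factorial)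
    (h : (k+1).factorial ≤ s + j) :
    ‖a s‖ * ‖x j‖ * ρ ^ (k+1).factorial ≤ (‖a s‖ * WW ρ s) * bb ρ x k j := by
  have hp : ρ ^ (k+1).factorial ≤ ρ ^ s * ρ ^ j := by
    rw [← pow_add]; exact pow_le_pow_right₀ hρ.le h
  have : ρ ^ (k+1).factorial ≤
      WW ρ s * (WW ρ j * (if j < (k+1).factorial then (1/2) ^ (k+1) else 1)) := by
    split_ifs with hj
    · have h1 := LL_key k s j hs hj h
      have h2 : (2:ℝ) ^ (k+1) ≤ 2 ^ LL s * 2 ^ LL j := by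
        rw [← pow_add]; exact pow_le_pow_right₀ (by norm_num) h1
      have h3 : (1:ℝ) ≤ 2 ^ LL s * 2 ^ LL j * (1/2) ^ (k+1) := by
        calc (1:ℝ) = 2 ^ (k+1) * (1/2) ^ (k+1) := by rw [← mul_pow]; norm_num
          _ ≤ _ := by gcongr
      calc ρ ^ (k+1).factorial ≤ ρ ^ s * ρ ^ j * 1 := by linarith
        _ ≤ ρ ^ s * ρ ^ j * (2 ^ LL s * 2 ^ LL j * (1/2) ^ (k+1)) := by gcongr
        _ = _ := by unfold WW; ring
    · rw [mul_one]
      exact hp.trans (mul_le_mul (WW_ge ρ hρ s) (WW_ge ρ hρ j) (by positivity) (WW_pos ρ hρ s).le)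
  calc _ ≤ ‖a s‖ * ‖x j‖ * (WW ρ s * (WW ρ j * (if j < (k+1).factorial then (1/2) ^ (k+1) else 1))) := by
        gcongr
    _ = _ := by unfold bb; ring

lemma bound0 (ρ : ℝ) (hρ : 1 < ρ) (a x : ℕ → ℂ) (ha : a ∈ l1wN (WW ρ)) (hx : x ∈ l1wN (WW ρ))
    (hx0 : x 0 = 0) (k : ℕ) :
    ‖aconv a x (k+1).factorial‖ * ρ ^ (k+1).factorial
      ≤ (∑' s, ‖a s‖ * WW ρ s) * ∑' j, bb ρ x k j := by
  have hr : 0 < ρ ^ (k+1).factorial := by positivity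
  rw [aconv_eq, Finset.sum_range_succ, Nat.sub_self, hx0, mul_zero, add_zero]
  calc _ ≤ (∑ s ∈ Finset.range (k+1).factorial, ‖a s * x ((k+1).factorial - s)‖)
        * ρ ^ (k+1).factorial := by gcongr; exact norm_sum_le _ _
    _ ≤ ∑ s ∈ Finset.range (k+1).factorial, (‖a s‖ * WW ρ s) * ∑' j, bb ρ x k j := by
        rw [Finset.sum_mul]
        refine Finset.sum_le_sum fun s hs => ?_
        have hs := Finset.mem_range.1 hs
        rw [norm_mul]
        refine (key_bound ρ hρ a x k s _ hs (by omega)).trans ?_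
        have := WW_pos ρ hρ s
        gcongr
        exact (bb_summable ρ hρ x hx k).le_tsum _ (fun j _ => bb_nonneg ρ hρ x k j)
    _ ≤ _ := by
        rw [← Finset.sum_mul]
        have : 0 ≤ ∑' j, bb ρ x k j := tsum_nonneg (bb_nonneg ρ hρ x k)
        gcongr
        exact Summable.sum_le_tsum _ (fun s _ => mul_nonneg (norm_nonneg _) (WW_pos ρ hρ s).le) ha

lemma l1_summable (ρ : ℝ) (hρ : 1 < ρ) (x : ℕ → ℂ) (hx : x ∈ l1wN (WW ρ)) :
    Summable (fun n => ‖x n‖) :=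
  Summable.of_nonneg_of_le (fun _ => norm_nonneg _)
    (fun n => le_mul_of_one_le_right (norm_nonneg _) ((WW_weight ρ hρ).1 n)) hx

lemma bound1 (ρ : ℝ) (hρ : 1 < ρ) (a x : ℕ → ℂ) (ha : a ∈ l1wN (WW ρ)) (hx : x ∈ l1wN (WW ρ))
    (hx0 : ∑' n, x n = 0) (k : ℕ) :
    ‖∑ n ∈ Finset.range (k+1).factorial, aconv a x n‖ * ρ ^ (k+1).factorial
      ≤ (∑' s, ‖a s‖ * WW ρ s) * ∑' j, bb ρ x k j := by
  have hr : 0 < ρ ^ (k+1).factorial := by positivity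
  have hsx := l1_summable ρ hρ x hx
  simp only [aconv_eq]
  rw [Finset.sum_range_diag_flip (k+1).factorial (fun s j => a s * x j)]
  calc _ ≤ (∑ s ∈ Finset.range (k+1).factorial,
          ‖∑ j ∈ Finset.range ((k+1).factorial - s), a s * x j‖)
        * ρ ^ (k+1).factorial := by gcongr; exact norm_sum_le _ _
    _ ≤ ∑ s ∈ Finset.range (k+1).factorial, (‖a s‖ * WW ρ s) * ∑' j, bb ρ x k j := by
        rw [Finset.sum_mul]
        refine Finset.sum_le_sum fun s hs => ?_
        have hs := Finset.mem_range.1 hs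
        set d := (k+1).factorial - s with hd
        have h1 : ‖∑ j ∈ Finset.range d, x j‖ ≤ ∑' j, ‖x (j + d)‖ := by
          have := hsx.of_norm.sum_add_tsum_nat_add d
          rw [hx0] at this
          rw [eq_neg_of_add_eq_zero_left this, norm_neg]
          exact norm_tsum_le_tsum_norm ((summable_nat_add_iff d).2 hsx)
        have hb := bb_summable ρ hρ x hx k
        have hW := WW_pos ρ hρ s
        rw [← Finset.mul_sum, norm_mul]
        calc _ ≤ ‖a s‖ * (∑' j, ‖x (j + d)‖) * ρ ^ (k+1).factorial := by gcongr
          _ = ∑' j, ‖a s‖ * ‖x (j + d)‖ * ρ ^ (k+1).factorial := by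
              rw [tsum_mul_right, tsum_mul_left]
          _ ≤ ∑' j, (‖a s‖ * WW ρ s) * bb ρ x k (j + d) := by
              refine Summable.tsum_le_tsum (fun j => key_bound ρ hρ a x k s _ hs (by omega)) ?_ ?_
              · exact (((summable_nat_add_iff d).2 hsx).mul_left _).mul_right _
              · exact ((summable_nat_add_iff d).2 hb).mul_left _
          _ = (‖a s‖ * WW ρ s) * ∑' j, bb ρ x k (j + d) := tsum_mul_left
          _ ≤ _ := by
              refine mul_le_mul_of_nonneg_left ?_ (by positivity)
              rw [← hb.sum_add_tsum_nat_add d]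
              have : 0 ≤ ∑ j ∈ Finset.range d, bb ρ x k j :=
                Finset.sum_nonneg fun j _ => bb_nonneg ρ hρ x k j
              linarith
    _ ≤ _ := by
        rw [← Finset.sum_mul]
        have : 0 ≤ ∑' j, bb ρ x k j := tsum_nonneg (bb_nonneg ρ hρ x k)
        gcongr
        exact Summable.sum_le_tsum _ (fun s _ => mul_nonneg (norm_nonneg _) (WW_pos ρ hρ s).le) ha

lemma exists_phi (θ : ℕ → ℝ) (hθ : Tendsto θ atTop (nhds 0)) :
    ∃ φ : ℕ → ℝ, (∀ k, 0 ≤ φ k) ∧ Summable φ ∧ ¬ ∃ C, 0 ≤ C ∧ ∀ k, φ k ≤ C * θ k := by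
  obtain ⟨κ, hκ, hκ2⟩ := extraction_forall_of_eventually
    (P := fun i k => θ k ≤ (1/4:ℝ) ^ i) (fun i => (hθ.eventually_le_const (by positivity)))
  refine ⟨Function.extend κ (fun i => (1/2:ℝ)^i) 0, fun k => ?_, ?_, ?_⟩
  · by_cases h : ∃ i, κ i = k
    · obtain ⟨i, rfl⟩ := h
      rw [hκ.injective.extend_apply]; positivity
    · rw [Function.extend_apply' _ _ _ h]; simp
  · rw [summable_extend_zero hκ.injective]
    exact summable_geometric_of_lt_one (by norm_num) (by norm_num)
  · rintro ⟨C, hC, h⟩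
    obtain ⟨i, hi⟩ := pow_unbounded_of_one_lt C (one_lt_two)
    have h1 := h (κ i)
    rw [hκ.injective.extend_apply] at h1
    have h2 : (1/2:ℝ)^i ≤ C * (1/4)^i := h1.trans (by gcongr; exact hκ2 i)
    have h3 : (4:ℝ)^i * (1/2)^i ≤ 4^i * (C * (1/4)^i) := by gcongr
    have h4 : (4:ℝ)^i * (1/2)^i = 2^i := by rw [← mul_pow]; norm_num
    have h5 : (4:ℝ)^i * (1/4)^i = 1 := by rw [← mul_pow]; norm_num
    nlinarith

lemma fact_inj : Function.Injective (fun k : ℕ => (k+1).factorial) :=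
  (strictMono_nat_of_lt_succ fun k =>
    (Nat.factorial_lt (n := k+1) (m := k+1+1) (by omega)).2 (by omega)).injective

lemma exists_g (ρ : ℝ) (hρ : 1 < ρ) (φ : ℕ → ℝ) (h0 : ∀ k, 0 ≤ φ k) (hs : Summable φ) :
    ∃ g : ℕ → ℝ, (∀ n, 0 ≤ g n) ∧ g 0 = 0 ∧ (Summable fun n => g n * WW ρ n) ∧
      ∀ k, g (k+1).factorial * ρ ^ (k+1).factorial = φ k := by
  have key : ∀ k, Function.extend (fun k : ℕ => (k+1).factorial)
    (fun k => φ k / ρ ^ (k+1).factorial) 0 (k+1).factorial = φ k / ρ ^ (k+1).factorial :=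
    fun k => fact_inj.extend_apply _ _ k
  refine ⟨Function.extend (fun k : ℕ => (k+1).factorial) (fun k => φ k / ρ ^ (k+1).factorial) 0,
    fun n => ?_, ?_, ?_, fun k => ?_⟩
  · by_cases h : ∃ i, (fun k : ℕ => (k+1).factorial) i = n
    · obtain ⟨i, rfl⟩ := h
      simp only [key]
      have := h0 i
      positivity
    · rw [Function.extend_apply' _ _ _ h]; simp
  · rw [Function.extend_apply']
    · simp
    · rintro ⟨i, hi⟩
      exact Nat.factorial_ne_zero _ hi
  · rw [← fact_inj.summable_iff]
    · refine Summable.of_nonneg_of_le (fun k => ?_) (fun k => ?_) (hs.mul_left 2)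
      · simp only [Function.comp, key]
        exact mul_nonneg (div_nonneg (h0 k) (by positivity)) (WW_pos ρ hρ _).le
      · simp only [Function.comp, key]
        have h1 : (2:ℝ) ^ LL (k+1).factorial ≤ 2 ^ 1 :=
          pow_le_pow_right₀ (by norm_num) (LL_fact _)
        have hr : ρ ^ (k+1).factorial ≠ 0 := by positivity
        have : φ k / ρ ^ (k+1).factorial * WW ρ (k+1).factorial = φ k * 2 ^ LL (k+1).factorial := by
          unfold WW; field_simp
        rw [this]
        nlinarith [h0 k]
    · intro n hn
      rw [Function.extend_apply' _ _ _ (by simpa using hn)]; simp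
  · rw [key]
    have hr : ρ ^ (k+1).factorial ≠ 0 := by positivity
    field_simp

lemma gen_mem (ω : ℕ → ℝ) (n : ℕ) (x : Fin n → (ℕ → ℂ)) (i : Fin n) :
    x i ∈ {f | ∃ a : Fin n → (ℕ → ℂ), (∀ i, a i ∈ l1wN ω) ∧ f = ∑ i, aconv (a i) (x i)} := by
  refine ⟨fun j => if j = i then Pi.single 0 1 else 0, fun j => ?_, ?_⟩
  · by_cases hj : j = i
    · simp only [hj, if_true]
      apply summable_of_ne_finset_zero (s := {0})
      intro b hb
      have : b ≠ 0 := by simpa using hb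
      simp [this]
    · simp [l1wN, hj]
  · rw [Finset.sum_eq_single i]
    · ext m
      rw [aconv_eq, Finset.sum_eq_single 0]
      · simp
      · intro b _ hb; simp [hb]
      · simp
    · intro j _ hj
      ext m
      simp [aconv_eq, hj]
    · simp

/-- the abstract contradiction: a family of functionals, majorised as in `bound0` / `bound1` -/
lemma not_fg (ρ : ℝ) (hρ : 1 < ρ) (I : Set (ℕ → ℂ)) (Λ : ℕ → (ℕ → ℂ) → ℂ)
    (hΛ : ∀ k n (y : Fin n → ℕ → ℂ), Λ k (∑ i, y i) = ∑ i, Λ k (y i))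
    (hbd : ∀ a x, a ∈ l1wN (WW ρ) → x ∈ l1wN (WW ρ) → x ∈ I → ∀ k,
      ‖Λ k (aconv a x)‖ * ρ ^ (k+1).factorial ≤ (∑' s, ‖a s‖ * WW ρ s) * ∑' j, bb ρ x k j)
    (hg : ∀ g : ℕ → ℝ, (∀ n, 0 ≤ g n) → g 0 = 0 → (Summable fun n => g n * WW ρ n) →
      ∃ f ∈ I, ∀ k, g (k+1).factorial ≤ ‖Λ k f‖) :
    ¬ IsFinGenIdealOfN (WW ρ) I := by
  rintro ⟨n, x, hx, hI⟩
  have hxI : ∀ i, x i ∈ I := fun i => by rw [hI]; exact gen_mem _ n x i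
  obtain ⟨φ, h0, hs, hC⟩ := exists_phi (fun k => ∑ i, ∑' j, bb ρ (x i) k j) (by
    simpa using tendsto_finsetSum Finset.univ (fun i _ => bb_tendsto ρ hρ (x i) (hx i)))
  obtain ⟨g, g0, g1, g2, g3⟩ := exists_g ρ hρ φ h0 hs
  obtain ⟨f, hf, hfk⟩ := hg g g0 g1 g2
  rw [hI] at hf
  obtain ⟨a, ha, rfl⟩ := hf
  have hα : ∀ i, 0 ≤ ∑' s, ‖a i s‖ * WW ρ s := fun i =>
    tsum_nonneg fun s => mul_nonneg (norm_nonneg _) (WW_pos ρ hρ s).le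
  refine hC ⟨∑ i, ∑' s, ‖a i s‖ * WW ρ s, Finset.sum_nonneg fun i _ => hα i, fun k => ?_⟩
  have hr : 0 < ρ ^ (k+1).factorial := by positivity
  rw [← g3]
  calc _ ≤ ‖Λ k (∑ i, aconv (a i) (x i))‖ * ρ ^ (k+1).factorial := by gcongr; exact hfk k
    _ ≤ (∑ i, ‖Λ k (aconv (a i) (x i))‖) * ρ ^ (k+1).factorial := by
        rw [hΛ]; gcongr; exact norm_sum_le _ _
    _ ≤ ∑ i, (∑' s, ‖a i s‖ * WW ρ s) * ∑' j, bb ρ (x i) k j := by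
        rw [Finset.sum_mul]
        exact Finset.sum_le_sum fun i _ => hbd _ _ (ha i) (hx i) (hxI i) k
    _ ≤ ∑ i, (∑' s, ‖a i s‖ * WW ρ s) * ∑ i, ∑' j, bb ρ (x i) k j := by
        refine Finset.sum_le_sum fun i _ => mul_le_mul_of_nonneg_left ?_ (hα i)
        exact Finset.single_le_sum (f := fun i => ∑' j, bb ρ (x i) k j)
          (fun i _ => tsum_nonneg (bb_nonneg ρ hρ (x i) k)) (Finset.mem_univ i)
    _ = _ := by rw [Finset.sum_mul]

/-- Theorem 7.5: for every `ρ > 1` there exists a weight `ω` on `ℤ⁺` with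
`lim_{n→∞} ωₙ^{1/n} = ρ` such that in `A = ℓ¹(ℤ⁺, ω)` neither the maximal ideal
`M₀ = {f ∈ A : f(0) = 0}` nor the augmentation ideal `M₁ = {f ∈ A : ∑ₙ f(n) = 0}`
is finitely generated as an ideal of `A` (even though both correspond to interior
points of the character space, the disc of radius `ρ`). -/
theorem stmt18 (ρ : ℝ) (hρ : 1 < ρ) :
    ∃ ω : ℕ → ℝ, IsWeightNat ω ∧
      Tendsto (fun n : ℕ => ω n ^ ((1 : ℝ) / n)) atTop (nhds ρ) ∧
      ¬ IsFinGenIdealOfN ω {f ∈ l1wN ω | f 0 = 0} ∧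
      ¬ IsFinGenIdealOfN ω {f ∈ l1wN ω | ∑' n, f n = 0} := by
  refine ⟨WW ρ, WW_weight ρ hρ, WW_lim ρ hρ, ?_, ?_⟩
  · refine not_fg ρ hρ _ (fun k f => f (k+1).factorial) ?_ ?_ ?_
    · intro k n y; simp
    · intro a x ha hx hxI k
      exact bound0 ρ hρ a x ha hx hxI.2 k
    · intro g g0 g1 g2
      refine ⟨fun n => (g n : ℂ), ⟨?_, by simp [g1]⟩, fun k => ?_⟩
      · refine g2.congr fun n => ?_
        rw [Complex.norm_real, Real.norm_of_nonneg (g0 n)]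
      · rw [Complex.norm_real, Real.norm_of_nonneg (g0 _)]
  · refine not_fg ρ hρ _ (fun k f => ∑ n ∈ Finset.range (k+1).factorial, f n) ?_ ?_ ?_
    · intro k n y
      simp only [Finset.sum_apply]
      exact Finset.sum_comm
    · intro a x ha hx hxI k
      exact bound1 ρ hρ a x ha hx hxI.2 k
    · intro g g0 g1 g2
      have gs : Summable g := Summable.of_nonneg_of_le g0
        (fun n => le_mul_of_one_le_right (g0 n) ((WW_weight ρ hρ).1 n)) g2
      let u : ℕ → ℝ := fun n => g n - (if n = 0 then ∑' j, g j else 0)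
      have hds : HasSum (fun n : ℕ => if n = 0 then ∑' j, g j else 0) (∑' j, g j) :=
        hasSum_ite_eq 0 _
      have hu : HasSum u 0 := by
        have := gs.hasSum.sub hds
        simpa [u] using this
      have hun : ∀ n, n ≠ 0 → u n = g n := fun n hn => by simp [u, hn]
      refine ⟨fun n => (u n : ℂ), ⟨?_, ?_⟩, fun k => ?_⟩
      · change Summable _
        rw [← summable_nat_add_iff 1]
        refine ((summable_nat_add_iff 1).2 g2).congr fun n => ?_
        have hn := hun (n+1) (by omega)
        simp only [hn]
        rw [Complex.norm_real, Real.norm_of_nonneg (g0 _)]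
      · have := hu.mapL Complex.ofRealCLM
        simpa using this.tsum_eq
      · have h1 := hu.summable.sum_add_tsum_nat_add (k+1).factorial
        rw [hu.tsum_eq] at h1
        have hp := Nat.factorial_pos (k+1)
        have h2 : g (k+1).factorial ≤ ∑' j, u (j + (k+1).factorial) := by
          have h3 : ∀ j, u (j + (k+1).factorial) = g (j + (k+1).factorial) :=
            fun j => hun _ (by omega)
          simp only [h3]
          have := ((summable_nat_add_iff (k+1).factorial).2 gs).le_tsum 0 (fun j _ => g0 _)
          simpa using this
        rw [← Complex.ofReal_sum, Complex.norm_real, eq_neg_of_add_eq_zero_left h1, norm_neg]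
        exact h2.trans (le_abs_self _)
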